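/- arXiv:2404.11175 — 3 statements merged into one kernel-verified Lean document; each statement's English description precedes it below -/
import Mathlib

section
/- (Pinching increases entropy, proof step of Theorem 1.) Let ι and κ be finite types, f : ι → κ, and let M : Matrix ι ι ℂ be Hermitian, positive semidefinite, with trace 1. Define the pinched matrix P(M) by P(M) i j = M i j if f i = f j, and 0 otherwise. Then the von Neumann entropy satisfies S(P(M)) ≥ S(M). -/
open scoped Classical Matrix ComplexOrder

namespace AQD

/-- Von Neumann entropy of a (Hermitian) matrix: `∑ i, -λ_i log λ_i` where `λ` are the
eigenvalues; defined to be `0` on non-Hermitian matrices. -/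
noncomputable def vnEntropy {n : Type*} [Fintype n] [DecidableEq n] (M : Matrix n n ℂ) : ℝ :=
  if hM : M.IsHermitian then ∑ i, (- hM.eigenvalues i * Real.log (hM.eigenvalues i)) else 0

/-- The pinching of a matrix along a function `f`: keep the entry `M i j` when `f i = f j`
and replace it by `0` otherwise. -/
def pinch {ι κ : Type*} [DecidableEq κ] (f : ι → κ) (M : Matrix ι ι ℂ) : Matrix ι ι ℂ :=
  fun i j => if f i = f j then M i j else 0

/-- If `diagonal μ` is the image of `diagonal l` under a unital trace-preserving Kraus map, then
the entropy of `μ` is at least that of `l`. -/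
theorem sum_negMulLog_le_of_kraus_diagonal {n κ : Type*} [Fintype n] [DecidableEq n] [Fintype κ]
    (W : κ → Matrix n n ℂ) (l μ : n → ℝ) (hl : ∀ i, 0 ≤ l i)
    (hW : ∑ c, W c * (W c)ᴴ = 1) (hW' : ∑ c, (W c)ᴴ * W c = 1)
    (h : Matrix.diagonal (fun i => (μ i : ℂ)) =
      ∑ c, W c * Matrix.diagonal (fun i => (l i : ℂ)) * (W c)ᴴ) :
    ∑ i, Real.negMulLog (l i) ≤ ∑ i, Real.negMulLog (μ i) := by
  let D : n → n → ℝ := fun k j => ∑ c, Complex.normSq (W c k j)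
  have hD : ∀ k j, 0 ≤ D k j := fun k j => Finset.sum_nonneg fun c _ => Complex.normSq_nonneg _
  have hrow : ∀ k, ∑ j, D k j = 1 := by
    intro k
    have hk := congrFun (congrFun hW k) k
    simp only [Matrix.sum_apply, Matrix.mul_apply, Matrix.conjTranspose_apply, RCLike.star_def,
      Complex.mul_conj, Matrix.one_apply_eq] at hk
    rw [Finset.sum_comm] at hk
    exact_mod_cast hk
  have hcol : ∀ j, ∑ k, D k j = 1 := by
    intro j
    have hj := congrFun (congrFun hW' j) j
    simp only [Matrix.sum_apply, Matrix.mul_apply, Matrix.conjTranspose_apply, RCLike.star_def,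
      ← Complex.normSq_eq_conj_mul_self, Matrix.one_apply_eq] at hj
    rw [Finset.sum_comm] at hj
    exact_mod_cast hj
  have hμ : ∀ k, ∑ j, D k j * l j = μ k := by
    intro k
    have hk := congrFun (congrFun h k) k
    rw [Matrix.diagonal_apply_eq, Matrix.sum_apply] at hk
    simp only [Matrix.mul_apply (N := (W _)ᴴ), Matrix.mul_diagonal, Matrix.conjTranspose_apply,
      RCLike.star_def, mul_right_comm _ _ (starRingEnd ℂ _), Complex.mul_conj] at hk
    rw [Finset.sum_comm] at hk
    simp only [D, Finset.sum_mul]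
    exact_mod_cast hk.symm
  calc ∑ j, Real.negMulLog (l j) = ∑ k, ∑ j, D k j * Real.negMulLog (l j) := by
        rw [Finset.sum_comm]
        simp only [← Finset.sum_mul, hcol, one_mul]
    _ ≤ ∑ k, Real.negMulLog (μ k) := by
        refine Finset.sum_le_sum fun k _ => ?_
        have := Real.concaveOn_negMulLog.le_map_sum (t := Finset.univ) (w := D k) (p := l)
          (fun j _ => hD k j) (hrow k) (fun j _ => hl j)
        simpa only [smul_eq_mul, hμ] using this

theorem vnEntropy_eq_sum_negMulLog {n : Type*} [Fintype n] [DecidableEq n] {M : Matrix n n ℂ}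
    (hM : M.IsHermitian) : vnEntropy M = ∑ i, Real.negMulLog (hM.eigenvalues i) := by
  simp only [vnEntropy, dif_pos hM, Real.negMulLog]

/-- A unital trace-preserving Kraus map does not decrease the von Neumann entropy. -/
theorem vnEntropy_le_of_kraus {n κ : Type*} [Fintype n] [DecidableEq n] [Fintype κ]
    (K : κ → Matrix n n ℂ) {A B : Matrix n n ℂ} (hA : A.PosSemidef)
    (hK : ∑ c, K c * (K c)ᴴ = 1) (hK' : ∑ c, (K c)ᴴ * K c = 1)
    (hB : B = ∑ c, K c * A * (K c)ᴴ) : vnEntropy A ≤ vnEntropy B := by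
  have hBh : B.IsHermitian := by
    rw [hB, Matrix.IsHermitian, Matrix.conjTranspose_sum]
    exact Finset.sum_congr rfl fun c _ => Matrix.isHermitian_mul_mul_conjTranspose _ hA.1
  rw [vnEntropy_eq_sum_negMulLog hA.1, vnEntropy_eq_sum_negMulLog hBh]
  let U : Matrix n n ℂ := hA.1.eigenvectorUnitary
  let V : Matrix n n ℂ := hBh.eigenvectorUnitary
  have hU : U * Uᴴ = 1 := Unitary.coe_mul_star_self hA.1.eigenvectorUnitary
  have hU' : Uᴴ * U = 1 := Unitary.coe_star_mul_self hA.1.eigenvectorUnitary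
  have hV : V * Vᴴ = 1 := Unitary.coe_mul_star_self hBh.eigenvectorUnitary
  have hV' : Vᴴ * V = 1 := Unitary.coe_star_mul_self hBh.eigenvectorUnitary
  have hAs : A = U * Matrix.diagonal (fun i => (hA.1.eigenvalues i : ℂ)) * Uᴴ :=
    hA.1.spectral_theorem
  have hBs : B = V * Matrix.diagonal (fun i => (hBh.eigenvalues i : ℂ)) * Vᴴ :=
    hBh.spectral_theorem
  refine sum_negMulLog_le_of_kraus_diagonal (fun c => Vᴴ * K c * U) _ _ hA.eigenvalues_nonneg
    ?_ ?_ ?_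
  · calc ∑ c, Vᴴ * K c * U * (Vᴴ * K c * U)ᴴ = ∑ c, Vᴴ * (K c * (U * Uᴴ) * (K c)ᴴ) * V := by
          simp only [Matrix.conjTranspose_mul, Matrix.conjTranspose_conjTranspose,
            Matrix.mul_assoc]
      _ = 1 := by
          simp only [hU, Matrix.mul_one]
          rw [← Finset.sum_mul, ← Finset.mul_sum, hK, Matrix.mul_one, hV']
  · calc ∑ c, (Vᴴ * K c * U)ᴴ * (Vᴴ * K c * U) = ∑ c, Uᴴ * ((K c)ᴴ * (V * Vᴴ) * K c) * U := by
          simp only [Matrix.conjTranspose_mul, Matrix.conjTranspose_conjTranspose,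
            Matrix.mul_assoc]
      _ = 1 := by
          simp only [hV, Matrix.mul_one]
          rw [← Finset.sum_mul, ← Finset.mul_sum, hK', Matrix.mul_one, hU']
  · generalize Matrix.diagonal (fun i => (hA.1.eigenvalues i : ℂ)) = L at hAs ⊢
    generalize Matrix.diagonal (fun i => (hBh.eigenvalues i : ℂ)) = N at hBs ⊢
    calc N = (Vᴴ * V) * N * (Vᴴ * V) := by rw [hV', Matrix.one_mul, Matrix.mul_one]
      _ = Vᴴ * (V * N * Vᴴ) * V := by simp only [Matrix.mul_assoc]
      _ = Vᴴ * (∑ c, K c * (U * L * Uᴴ) * (K c)ᴴ) * V := by rw [← hBs, ← hAs, ← hB]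
      _ = ∑ c, Vᴴ * K c * U * L * (Vᴴ * K c * U)ᴴ := by
          rw [Finset.mul_sum, Finset.sum_mul]
          simp only [Matrix.conjTranspose_mul, Matrix.conjTranspose_conjTranspose,
            Matrix.mul_assoc]

/-- The coordinate projection onto the fibre of `f` over `c`. -/
def fibreProj {ι κ : Type*} [DecidableEq ι] [DecidableEq κ] (f : ι → κ) (c : κ) :
    Matrix ι ι ℂ :=
  Matrix.diagonal fun i => if f i = c then 1 else 0

theorem conjTranspose_fibreProj {ι κ : Type*} [DecidableEq ι] [DecidableEq κ] (f : ι → κ)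
    (c : κ) : (fibreProj f c)ᴴ = fibreProj f c := by
  rw [fibreProj, Matrix.diagonal_conjTranspose]
  congr 1
  ext i
  simp only [Pi.star_apply]
  split_ifs <;> simp

theorem pinch_eq_sum_fibreProj {ι κ : Type*} [Fintype ι] [DecidableEq ι] [Fintype κ]
    [DecidableEq κ] (f : ι → κ) (M : Matrix ι ι ℂ) :
    pinch f M = ∑ c, fibreProj f c * M * fibreProj f c := by
  ext i j
  simp [pinch, fibreProj, Matrix.sum_apply, eq_comm]

theorem sum_fibreProj_mul_self {ι κ : Type*} [Fintype ι] [DecidableEq ι] [Fintype κ]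
    [DecidableEq κ] (f : ι → κ) : ∑ c, fibreProj f c * fibreProj f c = 1 := by
  ext i j
  simp [fibreProj, Matrix.sum_apply, Matrix.diagonal_apply, Matrix.one_apply]

/-- **Pinching increases entropy.** If `M` is a Hermitian positive semidefinite matrix with
trace `1`, then `S(P(M)) ≥ S(M)`. -/
theorem pinch_entropy_ge {ι κ : Type*} [Fintype ι] [DecidableEq ι] [Fintype κ] [DecidableEq κ]
    (f : ι → κ) (M : Matrix ι ι ℂ) (hM : M.IsHermitian) (hpos : M.PosSemidef)
    (htr : Matrix.trace M = 1) :
    vnEntropy (pinch f M) ≥ vnEntropy M := by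
  refine vnEntropy_le_of_kraus (fibreProj f) hpos ?_ ?_ ?_ <;>
    simp only [conjTranspose_fibreProj, sum_fibreProj_mul_self, pinch_eq_sum_fibreProj]

end AQD
end

section
/- (Optimal arrangement lemma, proof part 3 of Theorem 1.) Let K : ℕ, dA dB : Fin K → ℕ with dA k ≥ 1, dB k ≥ 1, and dA antitone; set D := Σ_k dA k · dB k and offset k := Σ_{k'<k} dA k' · dB k'. Let p : Fin D → ℝ be nonnegative and antitone (decreasingly sorted). For a permutation σ of Fin D define qσ k b := Σ_{a : Fin (dA k)} p (σ (offset k + b · (dA k) + a)), and let q := q_id (obtained from the identity permutation). Then for every permutation σ, the vector (qσ k b)_{k,b} is majorized by the vector (q k b)_{k,b}: their total sums are equal, and for every m, the sum of the m largest entries of qσ is at most the sum of the m largest entries of q. -/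
open scoped Classical Matrix ComplexOrder

namespace AQD

variable {K : ℕ}

/-- `offset k = ∑_{k' < k} dA k' * dB k'`. -/
def offset (dA dB : Fin K → ℕ) (k : Fin K) : ℕ :=
  ∑ k' ∈ Finset.Iio k, dA k' * dB k'

theorem idx_lt (dA dB : Fin K → ℕ) (k : Fin K) (b : Fin (dB k)) (a : Fin (dA k)) :
    offset dA dB k + (b : ℕ) * dA k + (a : ℕ) < ∑ k', dA k' * dB k' := by
  have ha := a.isLt
  have hb := b.isLt
  have h1 : (b : ℕ) * dA k + (a : ℕ) < dA k * dB k := by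
    have h2 : ((b : ℕ) + 1) * dA k ≤ dB k * dA k := Nat.mul_le_mul_right _ hb
    have h3 : (b : ℕ) * dA k + (a : ℕ) < ((b : ℕ) + 1) * dA k := by
      rw [Nat.add_mul, Nat.one_mul]; omega
    calc (b : ℕ) * dA k + (a : ℕ) < ((b : ℕ) + 1) * dA k := h3
      _ ≤ dB k * dA k := h2
      _ = dA k * dB k := Nat.mul_comm _ _
  have hsub : Finset.Iio k ⊆ (Finset.univ : Finset (Fin K)) := Finset.subset_univ _
  have hsplit : ∑ k' ∈ (Finset.univ : Finset (Fin K)) \ Finset.Iio k, dA k' * dB k' +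
      ∑ k' ∈ Finset.Iio k, dA k' * dB k' = ∑ k', dA k' * dB k' :=
    Finset.sum_sdiff hsub
  have hk : k ∈ (Finset.univ : Finset (Fin K)) \ Finset.Iio k := by simp
  have hle : dA k * dB k ≤ ∑ k' ∈ (Finset.univ : Finset (Fin K)) \ Finset.Iio k, dA k' * dB k' :=
    Finset.single_le_sum (f := fun k' => dA k' * dB k') (fun i _ => Nat.zero_le _) hk
  unfold offset
  omega

/-- The index `offset k + b * dA k + a` as an element of `Fin (∑_k dA k * dB k)`. -/
def idx (dA dB : Fin K → ℕ) (k : Fin K) (b : Fin (dB k)) (a : Fin (dA k)) :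
    Fin (∑ k', dA k' * dB k') :=
  ⟨offset dA dB k + (b : ℕ) * dA k + (a : ℕ), idx_lt dA dB k b a⟩

/-- Partial trace over subsystem `A`. -/
noncomputable def ptraceA (dA dB : Fin K → ℕ)
    (M : Matrix (Σ k : Fin K, Fin (dA k) × Fin (dB k)) (Σ k : Fin K, Fin (dA k) × Fin (dB k)) ℂ) :
    Matrix (Σ k : Fin K, Fin (dB k)) (Σ k : Fin K, Fin (dB k)) ℂ :=
  fun x y =>
    if h : y.1 = x.1 then ∑ a : Fin (dA x.1), M ⟨x.1, (a, x.2)⟩ ⟨x.1, (a, h ▸ y.2)⟩ else 0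

/-- `q k b = ∑_a p (offset k + b * dA k + a)`. -/
noncomputable def qval (dA dB : Fin K → ℕ) (p : Fin (∑ k', dA k' * dB k') → ℝ)
    (k : Fin K) (b : Fin (dB k)) : ℝ :=
  ∑ a : Fin (dA k), p (idx dA dB k b a)

/-- `v` is majorized by `w` (families over a finite index type): the total sums agree, and the
sum of `v` over any subset is at most the sum of `w` over some subset of the same cardinality
(equivalently, every sum of `m` entries of `v` is at most the sum of the `m` largest entries
of `w`). -/
def MajorizedBy {τ : Type*} [Fintype τ] [DecidableEq τ] (v w : τ → ℝ) : Prop :=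
  (∑ i, v i = ∑ i, w i) ∧
    ∀ s : Finset τ, ∃ t : Finset τ, t.card = s.card ∧ ∑ i ∈ s, v i ≤ ∑ i ∈ t, w i

/-- A finset on which a nonnegative function takes its largest values has at least the sum of any
finset that is not larger. -/
theorem sum_le_sum_of_card_le_of_forall_le {ι M : Type*} [DecidableEq ι] [AddCommMonoid M]
    [LinearOrder M] [IsOrderedAddMonoid M] {f : ι → M} (hf : ∀ i, 0 ≤ f i) {s t : Finset ι}
    (hst : s.card ≤ t.card) (ht : ∀ x ∈ t, ∀ y ∉ t, f y ≤ f x) :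
    ∑ i ∈ s, f i ≤ ∑ i ∈ t, f i := by
  have hcard : (s \ t).card ≤ (t \ s).card := by
    have h₁ := Finset.card_sdiff_add_card_inter s t
    have h₂ := Finset.card_sdiff_add_card_inter t s
    rw [Finset.inter_comm] at h₂
    omega
  rw [← Finset.sum_inter_add_sum_sdiff s t f, ← Finset.sum_inter_add_sum_sdiff t s f,
    Finset.inter_comm t s]
  refine add_le_add_right ?_ _
  rcases (s \ t).eq_empty_or_nonempty with h | h
  · rw [h, Finset.sum_empty]
    exact Finset.sum_nonneg fun i _ => hf i
  · obtain ⟨y, hy, hmax⟩ := (s \ t).exists_max_image f h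
    calc ∑ i ∈ s \ t, f i ≤ (s \ t).card • f y := Finset.sum_le_card_nsmul _ _ _ hmax
      _ ≤ (t \ s).card • f y := nsmul_le_nsmul_left (hf y) hcard
      _ ≤ ∑ i ∈ t \ s, f i := Finset.card_nsmul_le_sum _ _ _ fun x hx =>
          ht x (Finset.mem_sdiff.mp hx).1 y (Finset.mem_sdiff.mp hy).2

/-- Every admissible cardinality is attained by a finset that is initial with respect to `f`. -/
theorem exists_card_eq_forall_le {ι α : Type*} [Fintype ι] [LinearOrder α]
    (f : ι → α) {m : ℕ} (hm : m ≤ Fintype.card ι) :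
    ∃ t : Finset ι, t.card = m ∧ ∀ x ∈ t, ∀ y ∉ t, f x ≤ f y := by
  induction m with
  | zero => exact ⟨∅, by simp⟩
  | succ m ih =>
    obtain ⟨t, rfl, ht⟩ := ih (by omega)
    have hne : tᶜ.Nonempty := by
      rw [← Finset.card_pos, Finset.card_compl]
      omega
    obtain ⟨z, hz, hmin⟩ := tᶜ.exists_min_image f hne
    rw [Finset.mem_compl] at hz
    refine ⟨insert z t, Finset.card_insert_of_notMem hz, fun x hx y hy => ?_⟩
    rw [Finset.mem_insert, not_or] at hy
    rcases Finset.mem_insert.mp hx with rfl | hx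
    · exact hmin y (Finset.mem_compl.mpr hy.2)
    · exact ht x hx y hy.2

/-- The first index of the block `x = (k, b)`. -/
def blockStart (dA dB : Fin K → ℕ) (x : Σ k : Fin K, Fin (dB k)) : ℕ :=
  offset dA dB x.1 + (x.2 : ℕ) * dA x.1

theorem offset_add_le_offset (dA dB : Fin K → ℕ) {k l : Fin K} (h : k < l) :
    offset dA dB k + dA k * dB k ≤ offset dA dB l := by
  unfold offset
  rw [add_comm, ← Finset.sum_insert (f := fun k' => dA k' * dB k') (by simp)]
  refine Finset.sum_le_sum_of_subset fun i hi => ?_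
  rcases Finset.mem_insert.mp hi with rfl | hi
  · exact Finset.mem_Iio.mpr h
  · exact Finset.mem_Iio.mpr ((Finset.mem_Iio.mp hi).trans h)

theorem blockStart_add_le_of_fst_lt (dA dB : Fin K → ℕ) {x y : Σ k : Fin K, Fin (dB k)}
    (h : x.1 < y.1) : blockStart dA dB x + dA x.1 ≤ blockStart dA dB y := by
  have h₁ := offset_add_le_offset dA dB h
  have h₂ : ((x.2 : ℕ) + 1) * dA x.1 ≤ dB x.1 * dA x.1 := Nat.mul_le_mul_right _ x.2.isLt
  unfold blockStart
  rw [add_one_mul, mul_comm (dB x.1)] at h₂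
  omega

/-- Distinct blocks are disjoint intervals. -/
theorem blockStart_add_le_or (dA dB : Fin K → ℕ) {x y : Σ k : Fin K, Fin (dB k)} (h : x ≠ y) :
    blockStart dA dB x + dA x.1 ≤ blockStart dA dB y ∨
      blockStart dA dB y + dA y.1 ≤ blockStart dA dB x := by
  rcases lt_trichotomy x.1 y.1 with hk | hk | hk
  · exact .inl (blockStart_add_le_of_fst_lt dA dB hk)
  · obtain ⟨k, b⟩ := x
    obtain ⟨l, c⟩ := y
    obtain rfl : k = l := hk
    have key : ∀ {b c : Fin (dB k)}, b < c →
        blockStart dA dB ⟨k, b⟩ + dA k ≤ blockStart dA dB ⟨k, c⟩ := by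
      intro b c hbc
      have := Nat.mul_le_mul_right (dA k) (show (b : ℕ) + 1 ≤ c from hbc)
      rw [add_one_mul] at this
      simp only [blockStart]
      omega
    have hbc : b ≠ c := fun hbc => h (by rw [hbc])
    exact hbc.lt_or_gt.imp key key
  · exact .inr (blockStart_add_le_of_fst_lt dA dB hk)

theorem idx_bijective (dA dB : Fin K → ℕ) :
    Function.Bijective fun z : Σ x : (Σ k : Fin K, Fin (dB k)), Fin (dA x.1) =>
      idx dA dB z.1.1 z.1.2 z.2 := by
  rw [Fintype.bijective_iff_injective_and_card]
  constructor
  · rintro ⟨x, a⟩ ⟨y, c⟩ h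
    have hval : blockStart dA dB x + (a : ℕ) = blockStart dA dB y + (c : ℕ) :=
      congrArg Fin.val h
    obtain rfl : x = y := by
      by_contra hxy
      have := blockStart_add_le_or dA dB hxy
      have := a.isLt
      have := c.isLt
      omega
    obtain rfl : a = c := Fin.ext (by omega)
    rfl
  · simp [Fintype.card_sigma, Fintype.sum_sigma, mul_comm]

/-- **Optimal arrangement lemma.** If `p` is nonnegative and decreasingly sorted, then for any
permutation `σ` of the indices, the family `qσ k b = ∑_a p (σ (offset k + b * dA k + a))` is
majorized by the family `q k b = ∑_a p (offset k + b * dA k + a)` obtained from the identity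
permutation. -/
theorem optimal_arrangement
    (dA dB : Fin K → ℕ) (hA : ∀ k, 1 ≤ dA k) (hB : ∀ k, 1 ≤ dB k) (hAnti : Antitone dA)
    (p : Fin (∑ k', dA k' * dB k') → ℝ) (hp0 : ∀ i, 0 ≤ p i) (hp : Antitone p)
    (σ : Equiv.Perm (Fin (∑ k', dA k' * dB k'))) :
    MajorizedBy
      (fun kb : Σ k : Fin K, Fin (dB k) => ∑ a : Fin (dA kb.1), p (σ (idx dA dB kb.1 kb.2 a)))
      (fun kb : Σ k : Fin K, Fin (dB k) => ∑ a : Fin (dA kb.1), p (idx dA dB kb.1 kb.2 a)) := by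
  let φ := Equiv.ofBijective _ (idx_bijective dA dB)
  have hsum : ∀ (τ : Equiv.Perm (Fin (∑ k', dA k' * dB k')))
      (s : Finset (Σ k : Fin K, Fin (dB k))),
      ∑ x ∈ s, ∑ a : Fin (dA x.1), p (τ (idx dA dB x.1 x.2 a)) =
        ∑ i ∈ (s.sigma fun x => (Finset.univ : Finset (Fin (dA x.1)))).map
          (φ.trans τ).toEmbedding, p i := by
    intro τ s
    rw [Finset.sum_map, Finset.sum_sigma]
    rfl
  have hid := hsum (Equiv.refl _)
  simp only [Equiv.refl_apply] at hid
  refine ⟨?_, fun s => ?_⟩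
  · rw [hsum σ, hid]
    simpa using Equiv.sum_comp (φ.trans σ) p
  · obtain ⟨t, hcard, ht⟩ := exists_card_eq_forall_le (blockStart dA dB) s.card_le_univ
    have hlt : ∀ x ∈ t, ∀ y ∉ t, blockStart dA dB x + dA x.1 ≤ blockStart dA dB y := by
      intro x hx y hy
      have hxy : x ≠ y := fun h => hy (h ▸ hx)
      have := blockStart_add_le_or dA dB hxy
      have := ht x hx y hy
      have := hA y.1
      omega
    refine ⟨t, hcard, ?_⟩
    rw [hsum σ, hid]
    refine sum_le_sum_of_card_le_of_forall_le hp0 ?_ ?_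
    · simp only [Finset.card_map, Finset.card_sigma, Finset.card_univ, Fintype.card_fin]
      refine sum_le_sum_of_card_le_of_forall_le (fun _ => Nat.zero_le _) hcard.ge
        fun x hx y hy => hAnti ?_
      by_contra! hyx
      have := blockStart_add_le_of_fst_lt dA dB hyx
      have := hlt x hx y hy
      have := hA x.1
      have := hA y.1
      omega
    · intro u hu v hv
      obtain ⟨⟨y, c⟩, rfl⟩ := φ.surjective v
      obtain ⟨⟨x, a⟩, hx, rfl⟩ := Finset.mem_map.mp hu
      have hx : x ∈ t := (Finset.mem_sigma.mp hx).1
      have hy : y ∉ t := fun hy => hv <|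
        Finset.mem_map.mpr ⟨⟨y, c⟩, Finset.mem_sigma.mpr ⟨hy, Finset.mem_univ c⟩, rfl⟩
      refine hp ?_
      change blockStart dA dB x + (a : ℕ) ≤ blockStart dA dB y + (c : ℕ)
      have := hlt x hx y hy
      have := a.isLt
      omega

end AQD
end

section
/- (Grouping after sorting majorizes, proof step of Theorem 1, 'q^(U) ≺ q^(U)_↓'.) Let dA dB : ℕ with dA ≥ 1 and dB ≥ 1, and let x : Fin (dA · dB) → ℝ be nonnegative. Let x↓ denote the decreasing rearrangement of x. Define Q(v) b := Σ_{a : Fin dA} v (b · dA + a) for b : Fin dB. Then Q(x) is majorized by Q(x↓): Σ_b Q(x) b = Σ_b Q(x↓) b, and for every m ≤ dB and every subset s ⊆ Fin dB with card s = m, Σ_{b ∈ s} Q(x) b ≤ Σ_{b < m} Q(x↓) b. -/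
open scoped Classical Matrix ComplexOrder

namespace AQD

/-- The index `b * dA + a` as an element of `Fin (dA * dB)`. -/
def idx2 (dA dB : ℕ) (b : Fin dB) (a : Fin dA) : Fin (dA * dB) :=
  ⟨(b : ℕ) * dA + (a : ℕ), by
    have ha := a.isLt
    have hb := b.isLt
    calc (b : ℕ) * dA + (a : ℕ) < ((b : ℕ) + 1) * dA := by rw [Nat.add_mul, Nat.one_mul]; omega
      _ ≤ dB * dA := Nat.mul_le_mul_right _ hb
      _ = dA * dB := Nat.mul_comm _ _⟩

/-- Block sums: `Q v b = ∑_{a < dA} v (b * dA + a)`. -/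
def blockSum (dA dB : ℕ) (v : Fin (dA * dB) → ℝ) (b : Fin dB) : ℝ :=
  ∑ a : Fin dA, v (idx2 dA dB b a)

theorem idx2_bijective (dA dB : ℕ) :
    Function.Bijective (fun p : Fin dB × Fin dA => idx2 dA dB p.1 p.2) := by
  rw [Fintype.bijective_iff_injective_and_card]
  refine ⟨?_, by simp [Nat.mul_comm]⟩
  rintro ⟨b, a⟩ ⟨b', a'⟩ h
  have h' : (b : ℕ) * dA + a = b' * dA + a' := congrArg Fin.val h
  have hpos : 0 < dA := a.pos
  have hb : (b : ℕ) = b' := by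
    have := congrArg (· / dA) h'
    simpa [Nat.mul_comm _ dA, Nat.mul_add_div hpos, Nat.div_eq_of_lt] using this
  have ha : (a : ℕ) = a' := by
    rw [hb] at h'
    omega
  exact Prod.ext (Fin.ext hb) (Fin.ext ha)

/-- `idx2` as an equivalence. -/
noncomputable def idxEquiv (dA dB : ℕ) : Fin dB × Fin dA ≃ Fin (dA * dB) :=
  Equiv.ofBijective _ (idx2_bijective dA dB)

theorem sum_blockSum (dA dB : ℕ) (v : Fin (dA * dB) → ℝ) (s : Finset (Fin dB)) :
    ∑ b ∈ s, blockSum dA dB v b =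
      ∑ i ∈ (s ×ˢ Finset.univ).map (idxEquiv dA dB).toEmbedding, v i := by
  rw [Finset.sum_map, Finset.sum_product]
  rfl

theorem sum_le_sum_of_threshold {ι : Type*} {f : ι → ℝ} {c : ℝ} {s t : Finset ι}
    (hcard : s.card = t.card) (hin : ∀ i ∈ t, c ≤ f i) (hout : ∀ i ∉ t, f i ≤ c) :
    ∑ i ∈ s, f i ≤ ∑ i ∈ t, f i := by
  have h1 : ∑ i ∈ s \ t, f i ≤ (s \ t).card • c :=
    Finset.sum_le_card_nsmul _ _ _ fun i hi => hout i (Finset.mem_sdiff.1 hi).2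
  have h2 : (t \ s).card • c ≤ ∑ i ∈ t \ s, f i :=
    Finset.card_nsmul_le_sum _ _ _ fun i hi => hin i (Finset.mem_sdiff.1 hi).1
  rw [Finset.card_sdiff_comm hcard] at h1
  have h3 := Finset.sum_inter_add_sum_sdiff s t f
  have h4 := Finset.sum_inter_add_sum_sdiff t s f
  rw [Finset.inter_comm] at h4
  linarith

/-- **Grouping after sorting majorizes.** Let `x` be nonnegative and let `xs` be its
decreasing rearrangement (an antitone function obtained from `x` by composing with a
permutation). Then the block sums `Q(x)` are majorized by the block sums `Q(xs)`: the totals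
agree and, for every `m ≤ dB`, the sum of any `m` entries of `Q(x)` is at most the sum of the
first (largest) `m` entries of `Q(xs)`. -/
theorem blockSum_majorized_by_sorted (dA dB : ℕ) (hA : 1 ≤ dA) (hB : 1 ≤ dB)
    (x xs : Fin (dA * dB) → ℝ) (hx0 : ∀ i, 0 ≤ x i) (hxs : Antitone xs)
    (hperm : ∃ π : Equiv.Perm (Fin (dA * dB)), ∀ i, xs i = x (π i)) :
    (∑ b : Fin dB, blockSum dA dB x b = ∑ b : Fin dB, blockSum dA dB xs b) ∧
      ∀ m ≤ dB, ∀ s : Finset (Fin dB), s.card = m →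
        ∑ b ∈ s, blockSum dA dB x b ≤
          ∑ b ∈ Finset.univ.filter (fun b : Fin dB => (b : ℕ) < m), blockSum dA dB xs b := by
  obtain ⟨π, hπ⟩ := hperm
  have hx (t : Finset (Fin (dA * dB))) :
      ∑ i ∈ t, x i = ∑ i ∈ t.map π.symm.toEmbedding, xs i := by
    simp [Finset.sum_map, hπ]
  constructor
  · rw [sum_blockSum, sum_blockSum, hx]
    simp
  · rintro m hm s rfl
    rcases s.eq_empty_or_nonempty with rfl | hs
    · simp
    have hpos : 0 < s.card := hs.card_pos
    rw [sum_blockSum, sum_blockSum, hx]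
    refine sum_le_sum_of_threshold
      (c := xs (idx2 dA dB ⟨s.card - 1, by omega⟩ ⟨dA - 1, by omega⟩)) ?_ ?_ ?_
    · have hcard : (Finset.univ.filter fun b : Fin dB => (b : ℕ) < s.card).card = s.card := by
        rw [Fin.card_filter_val_lt, min_eq_right hm]
      simp only [Finset.card_map, Finset.card_product, hcard]
    · intro i hi
      obtain ⟨⟨b, a⟩, hp, rfl⟩ := Finset.mem_map.1 hi
      have hb : (b : ℕ) < s.card := by simpa using hp
      apply hxs
      change (b : ℕ) * dA + a ≤ (s.card - 1) * dA + (dA - 1)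
      have := Nat.mul_le_mul_right dA (Nat.le_sub_one_of_lt hb)
      have := a.isLt
      omega
    · intro i hi
      obtain ⟨⟨b, a⟩, rfl⟩ := (idxEquiv dA dB).surjective i
      have hb : s.card ≤ (b : ℕ) := by simpa using hi
      apply hxs
      change (s.card - 1) * dA + (dA - 1) ≤ (b : ℕ) * dA + a
      have h := Nat.mul_le_mul_right dA hb
      obtain ⟨k, hk⟩ : ∃ k, s.card = k + 1 := ⟨s.card - 1, by omega⟩
      rw [hk, Nat.add_mul, Nat.one_mul] at h
      rw [hk, Nat.add_sub_cancel]
      omega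

end AQD
end
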